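/- Let h : R^n -> R^k be differentiable, H positive semidefinite, tau > 0, and let U be an orthogonal n x n matrix with columns u_1,...,u_n. Define gamma_i = h(x + tau u_i) - h(x) - tau (nabla h(x + tau xi_i u_i)^T - nabla h(x)^T) u_i, where xi_i in (0,1) are the mean-value-theorem parameters satisfying h(x + tau u_i) - h(x) = nabla h(x + tau xi_i u_i)^T (tau u_i). Then tau^2 ||nabla h(x)^T||_H^2 = sum_{i=1}^n ||gamma_i||_H^2. -/

import Mathlib

open Matrix

/-- The trace of `Mᵀ * H * M` is the sum of the values of the quadratic form `H` at the
columns of `M`. -/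
theorem trace_transpose_mul_mul_eq_sum_col {m n R : Type*} [Fintype m] [Fintype n] [CommSemiring R]
    (H : Matrix m m R) (M : Matrix m n R) :
    (Mᵀ * H * M).trace = ∑ i, M.col i ⬝ᵥ H *ᵥ M.col i := by
  rw [Matrix.mul_assoc]
  rfl

/-- The `H`-Frobenius norm is invariant under right multiplication by a matrix with
orthonormal rows. -/
theorem trace_transpose_mul_mul_mul_of_mul_transpose_eq_one {m n p R : Type*} [Fintype m]
    [Fintype n] [Fintype p] [DecidableEq n] [CommSemiring R] (H : Matrix m m R) (M : Matrix m n R)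
    {U : Matrix n p R} (hU : U * Uᵀ = 1) :
    ((M * U)ᵀ * H * (M * U)).trace = (Mᵀ * H * M).trace := by
  calc ((M * U)ᵀ * H * (M * U)).trace = (Uᵀ * (Mᵀ * H * M * U)).trace := by
        simp only [transpose_mul, Matrix.mul_assoc]
    _ = (Mᵀ * H * M).trace := by
        rw [trace_mul_comm, Matrix.mul_assoc, hU, Matrix.mul_one]

/-- Algebraic identity (key step of Theorem 2): with γ_i the mean-value-theorem
residuals along the columns of an orthogonal matrix U,
τ²‖∇h(x)ᵀ‖_H² = ∑_i ‖γ_i‖_H². -/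
theorem stmt13 {n k : ℕ}
    (H : Matrix (Fin k) (Fin k) ℝ) (hH : H.PosSemidef)
    (h : (Fin n → ℝ) → (Fin k → ℝ))
    (Dh : (Fin n → ℝ) → Matrix (Fin k) (Fin n) ℝ)
    (τ : ℝ) (hτ : 0 < τ)
    (U : Matrix (Fin n) (Fin n) ℝ) (hU1 : Uᵀ * U = 1) (hU2 : U * Uᵀ = 1)
    (x : Fin n → ℝ) (ξ : Fin n → ℝ) (hξ : ∀ i, ξ i ∈ Set.Ioo (0 : ℝ) 1)
    (hmvt : ∀ i, h (x + τ • (fun j => U j i)) - h x =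
      (Dh (x + (τ * ξ i) • (fun j => U j i))).mulVec (τ • (fun j => U j i)))
    (γ : Fin n → (Fin k → ℝ))
    (hγ : ∀ i, γ i = h (x + τ • (fun j => U j i)) - h x -
      τ • ((Dh (x + (τ * ξ i) • (fun j => U j i)) - Dh x).mulVec (fun j => U j i))) :
    τ ^ 2 * ((Dh x)ᵀ * H * Dh x).trace = ∑ i, γ i ⬝ᵥ H.mulVec (γ i) := by
  have hcol (i : Fin n) : γ i = τ • (Dh x * U).col i := by
    rw [hγ, hmvt, mulVec_smul, ← smul_sub, sub_mulVec, sub_sub_cancel]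
    rfl
  rw [← trace_transpose_mul_mul_mul_of_mul_transpose_eq_one H (Dh x) hU2,
    trace_transpose_mul_mul_eq_sum_col, Finset.mul_sum]
  refine Finset.sum_congr rfl fun i _ => ?_
  rw [hcol, mulVec_smul, smul_dotProduct, dotProduct_smul, smul_eq_mul, smul_eq_mul]
  ring
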